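/- arXiv:2512.15759 — 3 statements merged into one kernel-verified Lean document; each statement's English description precedes it below -/
import Mathlib

section
/- Let K ≥ 1, let n_1, …, n_K > 0, let ρ ∈ [0,1), and let s_1, …, s_K satisfy 1 − ρ ≤ s_k ≤ 1 for all k. Define the SCFA weights α_k = n_k·s_k / Σ_j n_j·s_j and the FedAvg weights β_k = n_k / Σ_j n_j. Then for any vectors Δ_1, …, Δ_K in a real normed space with ‖Δ_k‖ ≤ B for all k, the aggregated updates satisfy ‖Σ_k α_k·Δ_k − Σ_k β_k·Δ_k‖ ≤ (ρ/(1−ρ))·B. -/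
/-- Reweighting a nonnegative quantity `a` of total `N` by a score `t ∈ [1 - ρ, 1]`, with total
reweighted mass `S ∈ [(1 - ρ) N, N]`, changes its share by a relative factor of at most
`ρ / (1 - ρ)`. -/
theorem abs_mul_div_sub_div_le {a t S N ρ : ℝ} (ha : 0 ≤ a) (hN : 0 < N) (hρ : ρ < 1)
    (ht : 1 - ρ ≤ t) (ht' : t ≤ 1) (hS : (1 - ρ) * N ≤ S) (hS' : S ≤ N) :
    |a * t / S - a / N| ≤ ρ / (1 - ρ) * (a / N) := by
  have hρ' : 0 < 1 - ρ := by linarith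
  have hS0 : 0 < S := (mul_pos hρ' hN).trans_le hS
  have habs : |t * N - S| ≤ ρ * N := by
    rw [abs_le]
    constructor <;> nlinarith
  have hρN : 0 ≤ ρ * N := (abs_nonneg _).trans habs
  calc |a * t / S - a / N| = a / N * (|t * N - S| / S) := by
        rw [show a * t / S - a / N = a / N * ((t * N - S) / S) by field_simp,
          abs_mul, abs_div (t * N - S), abs_of_nonneg (div_nonneg ha hN.le), abs_of_pos hS0]
    _ ≤ a / N * (ρ * N / ((1 - ρ) * N)) := by gcongr
    _ = ρ / (1 - ρ) * (a / N) := by rw [mul_div_mul_right _ _ hN.ne', mul_comm]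

/-- Perturbation bound: if all validity scores satisfy `1 − ρ ≤ s_k ≤ 1` and all client
updates have norm at most B, then the SCFA aggregated update differs from the FedAvg
aggregated update by at most `(ρ/(1−ρ))·B` in norm. -/
theorem scfa_fedavg_perturbation
    {V : Type*} [NormedAddCommGroup V] [NormedSpace ℝ V]
    (K : ℕ) (hK : 1 ≤ K)
    (n : Fin K → ℝ) (hn : ∀ k, 0 < n k)
    (ρ : ℝ) (hρ0 : 0 ≤ ρ) (hρ1 : ρ < 1)
    (s : Fin K → ℝ) (hs : ∀ k, 1 - ρ ≤ s k ∧ s k ≤ 1)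
    (α : Fin K → ℝ) (hα : ∀ k, α k = n k * s k / ∑ j, n j * s j)
    (β : Fin K → ℝ) (hβ : ∀ k, β k = n k / ∑ j, n j)
    (Δ : Fin K → V) (B : ℝ) (hB : ∀ k, ‖Δ k‖ ≤ B) :
    ‖(∑ k, α k • Δ k) - ∑ k, β k • Δ k‖ ≤ (ρ / (1 - ρ)) * B := by
  have : Nonempty (Fin K) := ⟨⟨0, hK⟩⟩
  have hN : 0 < ∑ j, n j := Finset.sum_pos (fun j _ => hn j) Finset.univ_nonempty
  have hS : (1 - ρ) * ∑ j, n j ≤ ∑ j, n j * s j := by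
    rw [Finset.mul_sum]
    exact Finset.sum_le_sum fun j _ => by nlinarith [hn j, (hs j).1]
  have hS' : ∑ j, n j * s j ≤ ∑ j, n j :=
    Finset.sum_le_sum fun j _ => mul_le_of_le_one_right (hn j).le (hs j).2
  have hβ_sum : ∑ k, β k = 1 := by
    simp_rw [hβ]
    rw [← Finset.sum_div, div_self hN.ne']
  have hαβ (k : Fin K) : |α k - β k| ≤ ρ / (1 - ρ) * β k := by
    rw [hα, hβ]
    exact abs_mul_div_sub_div_le (hn k).le hN hρ1 (hs k).1 (hs k).2 hS hS'
  rw [← Finset.sum_sub_distrib]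
  calc ‖∑ k, (α k • Δ k - β k • Δ k)‖ ≤ ∑ k, ρ / (1 - ρ) * β k * B :=
        norm_sum_le_of_le _ fun k _ => by
          rw [← sub_smul, norm_smul, Real.norm_eq_abs]
          exact mul_le_mul (hαβ k) (hB k) (norm_nonneg _) ((abs_nonneg _).trans (hαβ k))
    _ = ρ / (1 - ρ) * B := by rw [← Finset.sum_mul, ← Finset.mul_sum, hβ_sum, mul_one]
end

section
/- Let E be a real inner product space, let F : E → ℝ be differentiable with L-Lipschitz gradient (L > 0), let η > 0, and define gradient descent iterates by w_{e+1} = w_e − η·∇F(w_e) starting from w_0. Then for every e ≥ 0: (i) ‖∇F(w_e)‖ ≤ (1 + η·L)^e · ‖∇F(w_0)‖, and (ii) ‖w_e − w_0‖ ≤ ((1 + η·L)^e − 1)/L · ‖∇F(w_0)‖. -/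
/-- Client-drift lemma for the local training phase of SCFA: along gradient descent
iterates on an L-smooth function, (i) the gradient norm grows at most like
(1 + ηL)^e, and (ii) the displacement from the starting point is at most
((1 + ηL)^e − 1)/L times the initial gradient norm. -/
theorem client_drift
    {E : Type*} [NormedAddCommGroup E] [InnerProductSpace ℝ E] [CompleteSpace E]
    (F : E → ℝ) (hF : Differentiable ℝ F)
    (L : ℝ) (hL : 0 < L)
    (hLip : ∀ x y, ‖gradient F x - gradient F y‖ ≤ L * ‖x - y‖)
    (η : ℝ) (hη : 0 < η)
    (w : ℕ → E) (hrec : ∀ e : ℕ, w (e + 1) = w e - η • gradient F (w e)) :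
    ∀ e : ℕ,
      ‖gradient F (w e)‖ ≤ (1 + η * L) ^ e * ‖gradient F (w 0)‖ ∧
      ‖w e - w 0‖ ≤ ((1 + η * L) ^ e - 1) / L * ‖gradient F (w 0)‖ := by
  have hstep (e : ℕ) : ‖w (e + 1) - w e‖ = η * ‖gradient F (w e)‖ := by
    rw [hrec, sub_sub_cancel_left, norm_neg, norm_smul, Real.norm_of_nonneg hη.le]
  intro e
  induction e with
  | zero => simp
  | succ e ih =>
    obtain ⟨hgrad, hdist⟩ := ih
    constructor
    · calc
        ‖gradient F (w (e + 1))‖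
            ≤ ‖gradient F (w e)‖ + ‖gradient F (w (e + 1)) - gradient F (w e)‖ :=
          norm_le_insert' _ _
        _ ≤ ‖gradient F (w e)‖ + L * (η * ‖gradient F (w e)‖) := by
          rw [← hstep]
          gcongr
          exact hLip _ _
        _ = (1 + η * L) * ‖gradient F (w e)‖ := by ring
        _ ≤ (1 + η * L) * ((1 + η * L) ^ e * ‖gradient F (w 0)‖) := by gcongr
        _ = (1 + η * L) ^ (e + 1) * ‖gradient F (w 0)‖ := by ring
    · calc
        ‖w (e + 1) - w 0‖ ≤ ‖w (e + 1) - w e‖ + ‖w e - w 0‖ :=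
          norm_sub_le_norm_sub_add_norm_sub _ _ _
        _ ≤ η * ((1 + η * L) ^ e * ‖gradient F (w 0)‖)
            + ((1 + η * L) ^ e - 1) / L * ‖gradient F (w 0)‖ := by
          rw [hstep]
          gcongr
        _ = ((1 + η * L) ^ (e + 1) - 1) / L * ‖gradient F (w 0)‖ := by
          field_simp
          ring
end

section
/- Let E be a real inner product space, let F : E → ℝ be differentiable with L-Lipschitz gradient (L > 0), let E_loc ≥ 1 be an integer, let 0 < η ≤ 1/(L·E_loc), and define gradient descent iterates w_{e+1} = w_e − η·∇F(w_e) starting from w_0. Then for every 0 ≤ e ≤ E_loc, ‖w_e − w_0‖ ≤ (Real.exp 1 − 1)/L · ‖∇F(w_0)‖. -/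
/-- Explicit Euler iterates of an `L`-Lipschitz vector field drift from their starting point at most
geometrically. -/
theorem mul_norm_euler_sub_le {E : Type*} [NormedAddCommGroup E] [NormedSpace ℝ E]
    {G : E → E} {L η : ℝ} (hL : 0 ≤ L) (hη : 0 ≤ η)
    (hG : ∀ x y, ‖G x - G y‖ ≤ L * ‖x - y‖)
    {w : ℕ → E} (hw : ∀ n, w (n + 1) = w n - η • G (w n)) (n : ℕ) :
    L * ‖w n - w 0‖ ≤ ((1 + η * L) ^ n - 1) * ‖G (w 0)‖ := by
  induction n with
  | zero => simp
  | succ n ih =>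
    have hgrad : ‖G (w n)‖ ≤ L * ‖w n - w 0‖ + ‖G (w 0)‖ := by
      have := norm_le_norm_sub_add (G (w n)) (G (w 0))
      linarith [hG (w n) (w 0)]
    have hstep : ‖w (n + 1) - w 0‖ ≤ ‖w n - w 0‖ + η * ‖G (w n)‖ := by
      rw [hw, sub_right_comm]
      simpa [norm_smul, abs_of_nonneg hη] using norm_sub_le (w n - w 0) (η • G (w n))
    calc L * ‖w (n + 1) - w 0‖
        ≤ L * (‖w n - w 0‖ + η * (L * ‖w n - w 0‖ + ‖G (w 0)‖)) := by
          gcongr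
          exact hstep.trans (by gcongr)
      _ = (1 + η * L) * (L * ‖w n - w 0‖) + η * L * ‖G (w 0)‖ := by ring
      _ ≤ (1 + η * L) * (((1 + η * L) ^ n - 1) * ‖G (w 0)‖) + η * L * ‖G (w 0)‖ := by gcongr
      _ = ((1 + η * L) ^ (n + 1) - 1) * ‖G (w 0)‖ := by ring

/-- Uniform drift bound under the learning-rate condition η ≤ 1/(L·E_loc) of Theorem 1:
over at most E_loc local gradient descent epochs, each client's iterate stays within
(e − 1)/L times the initial gradient norm of the shared global model. -/
theorem uniform_client_drift
    {E : Type*} [NormedAddCommGroup E] [InnerProductSpace ℝ E] [CompleteSpace E]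
    (F : E → ℝ) (hF : Differentiable ℝ F)
    (L : ℝ) (hL : 0 < L)
    (hLip : ∀ x y, ‖gradient F x - gradient F y‖ ≤ L * ‖x - y‖)
    (Eloc : ℕ) (hEloc : 1 ≤ Eloc)
    (η : ℝ) (hη0 : 0 < η) (hη1 : η ≤ 1 / (L * Eloc))
    (w : ℕ → E) (hrec : ∀ e : ℕ, w (e + 1) = w e - η • gradient F (w e)) :
    ∀ e : ℕ, e ≤ Eloc →
      ‖w e - w 0‖ ≤ (Real.exp 1 - 1) / L * ‖gradient F (w 0)‖ := by
  intro e he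
  have hpos : (0 : ℝ) < Eloc := by exact_mod_cast hEloc
  have hηL : η * (L * Eloc) ≤ 1 := (le_div_iff₀ (by positivity)).1 hη1
  have hexp : (1 + η * L) ^ e ≤ Real.exp 1 := calc
    (1 + η * L) ^ e ≤ (1 + η * L) ^ Eloc :=
      pow_le_pow_right₀ (le_add_of_nonneg_right (by positivity)) he
    _ ≤ Real.exp (η * L) ^ Eloc := by
      gcongr
      linarith [Real.add_one_le_exp (η * L)]
    _ = Real.exp (η * (L * Eloc)) := by rw [← Real.exp_nat_mul]; ring_nf
    _ ≤ Real.exp 1 := Real.exp_le_exp.2 hηL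
  rw [div_mul_eq_mul_div, le_div_iff₀' hL]
  exact (mul_norm_euler_sub_le hL.le hη0.le hLip hrec e).trans (by gcongr)
end
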